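/- If H is a 1D spin Hamiltonian whose image H(𝒟) is an unbounded subset of ℤ (i.e., H is not effectively 0D), then its language with binary energy encoding L_H^b is not a context-free language. -/

import Mathlib

/-- The finite alphabet of the language: Σ_q ∪ [p] ∪ auxiliary symbols. -/
inductive Symb (q p : ℕ) : Type where
  | spin (s : Fin q)      -- a spin symbol from Σ_q
  | ham (α : Fin p)       -- a local-Hamiltonian label from [p]
  | lhd                   -- ◁
  | rhd                   -- ▷
  | sq                    -- □
  | dia                   -- ◇
  | tri                   -- ▲
  | blank                 -- ␣
  | comp                  -- ∘
  | bullet                -- •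
  | plus                  -- +
  | minus                 -- −
  | zero                  -- 0
  | one                   -- 1
  deriving DecidableEq, Fintype

/-- A local interaction `I = (α, A)`: a label `α ∈ [p]` together with a tuple of `k`
addresses, each an integer or the missing-spin symbol ▲ (modelled as `none`). -/
abbrev LocInt (k p : ℕ) := Fin p × (Fin k → Option ℤ)

/-- A configuration `(s_1, I_1, …, s_n, I_n)` (positions are 0-based here). -/
abbrev Config (q k p : ℕ) := List (Fin q × LocInt k p)

/-- The spin addressed by address `a` relative to (0-based) position `j`:
it is `▲` (`none`) whenever `a = ▲` or the addressed position lies outside `[n]`. -/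
def spinAt {q k p : ℕ} (x : Config q k p) (j : ℕ) : Option ℤ → Option (Fin q)
  | none => none
  | some l =>
      if 0 ≤ (j : ℤ) + l then (x[((j : ℤ) + l).toNat]?).map Prod.fst else none

/-- `H(s_1,I_1,…,s_n,I_n) = Σ_{j=1}^n h_{α_j}((s_{j+l})_{l ∈ A_j})`. -/
def energy {q k p : ℕ} (h : Fin p → (Fin k → Option (Fin q)) → ℤ)
    (x : Config q k p) : ℤ :=
  ∑ j : Fin x.length, h (x.get j).2.1 (fun l => spinAt x (j : ℕ) ((x.get j).2.2 l))

/-- The unary encoding `u : ℤ → {◇,□}*`. -/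
def unary {q p : ℕ} (z : ℤ) : List (Symb q p) :=
  if 0 ≤ z then List.replicate z.toNat Symb.dia else List.replicate (-z).toNat Symb.sq

/-- Encoding of an address: `u(a)` for an integer `a`, and `▲` for the missing-spin symbol. -/
def encAddr {q p : ℕ} : Option ℤ → List (Symb q p)
  | none => [Symb.tri]
  | some z => unary z

/-- `γ(α, (a_1,…,a_k)) = α ◁ u(a_1) ␣ ⋯ ␣ u(a_k) ▷`. -/
def encInt {q k p : ℕ} (I : LocInt k p) : List (Symb q p) :=
  [Symb.ham I.1, Symb.lhd] ++
    List.intercalate [Symb.blank] (List.ofFn fun l => encAddr (I.2 l)) ++ [Symb.rhd]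

/-- `e(s_1,I_1,…,s_n,I_n) = s_1 γ(I_1) ⋯ s_n γ(I_n)`. -/
def encConfig {q k p : ℕ} (x : Config q k p) : List (Symb q p) :=
  (x.map fun si => Symb.spin si.1 :: encInt si.2).flatten

/-- `𝓘_{1D} ⊆ [p] × {−k,…,k}^k` and nonempty: each address is an integer in `{−k,…,k}`. -/
def Is1DIntSet {k p : ℕ} (S : Set (LocInt k p)) : Prop :=
  S.Nonempty ∧ ∀ I ∈ S, ∀ l : Fin k, ∃ a : ℤ, I.2 l = some a ∧ -(k : ℤ) ≤ a ∧ a ≤ k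

/-- The domain of a 1D spin Hamiltonian with constant interaction set `S = 𝓘_{1D}`:
all configurations of any length `n ≥ 1` with all local interactions drawn from `S`. -/
def Domain1D {k p : ℕ} (q : ℕ) (S : Set (LocInt k p)) : Set (Config q k p) :=
  {x | x ≠ [] ∧ ∀ j : Fin x.length, (x.get j).2 ∈ S}

/-- The binary encoding `b : ℤ → {+,−} × {0,1}*`: a sign symbol followed by the binary
digits `c_1 ⋯ c_m` of `|n|` (least significant first, `|n| = Σ_l c_l 2^{l−1}`). -/
def binEnc {q p : ℕ} (z : ℤ) : List (Symb q p) :=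
  (if 0 ≤ z then Symb.plus else Symb.minus) ::
    (z.natAbs.bits.map fun b => if b then Symb.one else Symb.zero)

/-- The language of `H` with binary energy encoding, `L_H^b = { e(x) ∘ b(H(x)) • : x ∈ 𝒟 }`. -/
def langHB {q k p : ℕ} (h : Fin p → (Fin k → Option (Fin q)) → ℤ)
    (D : Set (Config q k p)) : Language (Symb q p) :=
  {w | ∃ x ∈ D, w = encConfig x ++ [Symb.comp] ++ binEnc (energy h x) ++ [Symb.bullet]}

namespace ContextFreeGrammar

variable {T σ : Type*} {g : ContextFreeGrammar T} {M : DFA T σ}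

/-- `g.DerivesAlong M X p β q w`: the sentential form `β` derives the word `w`, which drives `M` from
state `p` to state `q`, by a forest of derivation trees whose internal nodes, annotated with the
states of `M` before and after their yield, lie in `X` and never repeat along a branch. -/
inductive DerivesAlong (g : ContextFreeGrammar T) (M : DFA T σ) :
    Set (g.NT × σ × σ) → σ → List (Symbol T g.NT) → σ → List T → Prop
  | nil (X : Set (g.NT × σ × σ)) (p : σ) : DerivesAlong g M X p [] p []
  | terminal {X : Set (g.NT × σ × σ)} {p q : σ} {β : List (Symbol T g.NT)} {w : List T} (a : T)
      (hw : DerivesAlong g M X (M.step p a) β q w) :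
      DerivesAlong g M X p (.terminal a :: β) q (a :: w)
  | nonterminal {X : Set (g.NT × σ × σ)} {p q s : σ} {β : List (Symbol T g.NT)} {v w : List T}
      (r : ContextFreeRule T g.NT) (hr : r ∈ g.rules) (hX : (r.input, p, s) ∈ X)
      (hv : DerivesAlong g M (X \ {(r.input, p, s)}) p r.output s v)
      (hw : DerivesAlong g M X s β q w) :
      DerivesAlong g M X p (.nonterminal r.input :: β) q (v ++ w)

namespace DerivesAlong

variable {X Y : Set (g.NT × σ × σ)} {p q s : σ} {β γ : List (Symbol T g.NT)} {v w : List T}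

lemma mono (hw : g.DerivesAlong M X p β q w) (hXY : X ⊆ Y) : g.DerivesAlong M Y p β q w := by
  induction hw generalizing Y with
  | nil => exact .nil _ _
  | terminal a _ ih => exact .terminal a (ih hXY)
  | nonterminal r hr hX _ _ ihv ihw =>
    exact .nonterminal r hr (hXY hX) (ihv (Set.sdiff_subset_sdiff_left hXY)) (ihw hXY)

lemma derives (hw : g.DerivesAlong M X p β q w) : g.Derives β (w.map .terminal) := by
  induction hw with
  | nil => exact Derives.refl _
  | terminal a _ ih => exact ih.append_left [.terminal a]
  | @nonterminal X p q s β v w r hr hX _ _ ihv ihw =>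
    have hr' : g.Produces [.nonterminal r.input] r.output := ⟨r, hr, .input_output⟩
    rw [List.map_append]
    exact ((hr'.trans_derives ihv).append_right β).trans (ihw.append_left _)

lemma evalFrom (hw : g.DerivesAlong M X p β q w) : M.evalFrom p w = q := by
  induction hw with
  | nil => rfl
  | terminal a _ ih => exact ih
  | nonterminal r hr hX _ _ ihv ihw => rw [DFA.evalFrom_of_append, ihv, ihw]

lemma append (hv : g.DerivesAlong M X p β s v) (hw : g.DerivesAlong M X s γ q w) :
    g.DerivesAlong M X p (β ++ γ) q (v ++ w) := by
  induction hv with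
  | nil => exact hw
  | terminal a _ ih => exact .terminal a (ih hw)
  | nonterminal r hr hX hv _ _ ihw =>
    rw [List.append_assoc]
    exact .nonterminal r hr hX hv (ihw hw)

lemma exists_of_append (hw : g.DerivesAlong M X p (β ++ γ) q w) :
    ∃ s u v, w = u ++ v ∧ g.DerivesAlong M X p β s u ∧ g.DerivesAlong M X s γ q v := by
  induction β generalizing p w with
  | nil => exact ⟨p, [], w, rfl, .nil _ _, hw⟩
  | cons b β ih =>
    cases hw with
    | terminal a hw =>
      obtain ⟨s, u, v, rfl, hu, hv⟩ := ih hw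
      exact ⟨s, a :: u, v, rfl, .terminal a hu, hv⟩
    | nonterminal r hr hX hv hw =>
      obtain ⟨s, u, v, rfl, hu, hv'⟩ := ih hw
      exact ⟨s, _, v, (List.append_assoc _ _ _).symm, .nonterminal r hr hX hv hu, hv'⟩

lemma of_terminals (X : Set (g.NT × σ × σ)) (p : σ) (w : List T) :
    g.DerivesAlong M X p (w.map .terminal) (M.evalFrom p w) w := by
  induction w generalizing p with
  | nil => exact .nil _ _
  | cons a w ih => exact .terminal a (ih _)

lemma length_le {U : Finset (g.NT × σ × σ)} {K : ℕ} (hK : 0 < K)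
    (hg : ∀ r ∈ g.rules, r.output.length ≤ K) (hw : g.DerivesAlong M U p β q w) :
    w.length ≤ β.length * K ^ U.card := by
  classical
  generalize hX : (U : Set (g.NT × σ × σ)) = X at hw
  induction hw generalizing U with
  | nil => simp
  | terminal a _ ih =>
    have := ih hX
    have := Nat.pow_pos (n := U.card) hK
    simp only [List.length_cons]
    linarith
  | @nonterminal X p q s β v w r hr hmem _ _ ihv ihw =>
    subst hX
    have h₁ := ihv (U := U.erase (r.input, p, s)) (by simp)
    have h₂ := ihw rfl
    have h₃ := Nat.mul_le_mul_right (K ^ (U.erase (r.input, p, s)).card) (hg r hr)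
    rw [← Nat.pow_succ', Nat.succ_eq_add_one, Finset.card_erase_add_one (by simpa using hmem)] at h₃
    simp only [List.length_cons, List.length_append]
    linarith

lemma avoid_or_exists (hw : g.DerivesAlong M X p β q w) (A : g.NT) (s t : σ) :
    g.DerivesAlong M (X \ {(A, s, t)}) p β q w ∨
      ∃ v x y, w = v ++ x ++ y ∧
        g.Derives β (v.map .terminal ++ [.nonterminal A] ++ y.map .terminal) ∧
        M.evalFrom p v = s ∧ M.evalFrom t y = q ∧
        g.DerivesAlong M X s [.nonterminal A] t x := by
  induction hw with
  | nil => exact .inl (.nil _ _)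
  | terminal a _ ih =>
    obtain ih | ⟨v, x, y, rfl, hd, hv, hy, hx⟩ := ih
    · exact .inl (.terminal a ih)
    · exact .inr ⟨a :: v, x, y, rfl, hd.append_left [.terminal a], hv, hy, hx⟩
  | @nonterminal X p q m β v w r hr hX hv hw ihv ihw =>
    have hr' : g.Produces [.nonterminal r.input] r.output := ⟨r, hr, .input_output⟩
    by_cases heq : (r.input, p, m) = (A, s, t)
    · obtain ⟨rfl, rfl, rfl⟩ : r.input = A ∧ p = s ∧ m = t := by simpa using heq
      refine .inr ⟨[], v, w, rfl, hw.derives.append_left [.nonterminal r.input], rfl, hw.evalFrom, ?_⟩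
      simpa using DerivesAlong.nonterminal r hr hX hv (.nil _ _)
    obtain ihv | ⟨v, x, y, rfl, hd, hv', hy, hx⟩ := ihv
    · obtain ihw | ⟨v', x, y, rfl, hd, hv', hy, hx⟩ := ihw
      · rw [sdiff_right_comm] at ihv
        exact .inl (.nonterminal r hr ⟨hX, heq⟩ ihv ihw)
      · refine .inr ⟨v ++ v', x, y, by simp, ?_, ?_, hy, hx⟩
        · have := ((hr'.trans_derives hv.derives).append_right β).trans (hd.append_left _)
          simpa using this
        · rw [DFA.evalFrom_of_append, hv.evalFrom, hv']
    · refine .inr ⟨v, x, y ++ w, by simp, ?_, hv', ?_, hx.mono Set.sdiff_subset⟩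
      · have := ((hr'.trans_derives hd).append_right β).trans (hw.derives.append_left _)
        simpa using this
      · rw [DFA.evalFrom_of_append, hy, hw.evalFrom]

end DerivesAlong

/-- `g.Pumpable M p β q`: some word derived from `β` and driving `M` from `p` to `q` can be pumped
by iterating a derivation of `v A y` from `A`, where `v` and `y` are loops of `M`. -/
def Pumpable (g : ContextFreeGrammar T) (M : DFA T σ) (p : σ) (β : List (Symbol T g.NT)) (q : σ) :
    Prop :=
  ∃ (A : g.NT) (u v x y z : List T) (s t : σ),
    g.Derives β (u.map .terminal ++ [.nonterminal A] ++ z.map .terminal) ∧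
    g.Derives [.nonterminal A] (v.map .terminal ++ [.nonterminal A] ++ y.map .terminal) ∧
    g.Derives [.nonterminal A] (x.map .terminal) ∧
    M.evalFrom p u = s ∧ M.evalFrom s v = s ∧ M.evalFrom s x = t ∧ M.evalFrom t y = t ∧
    M.evalFrom t z = q ∧ 0 < v.length + y.length

lemma derivesAlong_or_pumpable {U : Set (g.NT × σ × σ)}
    (hU : ∀ r ∈ g.rules, ∀ s t, (r.input, s, t) ∈ U) {β : List (Symbol T g.NT)} {w : List T}
    (hw : g.Derives β (w.map .terminal)) (p : σ) :
    g.DerivesAlong M U p β (M.evalFrom p w) w ∨ g.Pumpable M p β (M.evalFrom p w) := by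
  induction hw using Relation.ReflTransGen.head_induction_on with
  | refl => exact .inl (.of_terminals _ _ _)
  | @head β β' hβ hd ih =>
    obtain ih | ⟨A, u, v, x, y, z, s, t, h, hs⟩ := ih
    swap
    · exact .inr ⟨A, u, v, x, y, z, s, t, hβ.trans_derives h, hs⟩
    obtain ⟨r, hr, hrw⟩ := hβ
    obtain ⟨l, l', rfl, rfl⟩ := hrw.exists_parts
    obtain ⟨t, w', w₃, rfl, h', h₃⟩ := ih.exists_of_append
    obtain ⟨s, w₁, w₂, rfl, h₁, h₂⟩ := h'.exists_of_append
    have key (hav : g.DerivesAlong M (U \ {(r.input, s, t)}) s r.output t w₂) :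
        g.DerivesAlong M U p (l ++ [.nonterminal r.input] ++ l')
          (M.evalFrom p (w₁ ++ w₂ ++ w₃)) (w₁ ++ w₂ ++ w₃) := by
      refine (h₁.append ?_).append h₃
      simpa using DerivesAlong.nonterminal r hr (hU r hr s t) hav (.nil _ _)
    obtain hav | ⟨v, x, y, rfl, hd, hv, hy, hx⟩ := h₂.avoid_or_exists r.input s t
    · exact .inl (key hav)
    obtain hlen | hlen := Nat.eq_zero_or_pos (v.length + y.length)
    · obtain ⟨rfl, rfl⟩ : v = [] ∧ y = [] := by simpa using hlen
      refine .inl ?_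
      rw [List.nil_append, List.append_nil] at *
      exact (h₁.append hx).append h₃
    · refine .inr ⟨r.input, w₁, v, x, y, w₃, s, t, ?_, ?_, hx.derives, h₁.evalFrom, hv,
        hx.evalFrom, hy, h₃.evalFrom, hlen⟩
      · exact (((h₁.derives.append_right _).trans
          (Derives.refl _)).append_right _).trans (h₃.derives.append_left _)
      · exact Produces.trans_derives ⟨r, hr, .input_output⟩ hd

lemma Pumpable.exists_length {p q : σ} {β : List (Symbol T g.NT)} (h : g.Pumpable M p β q) :
    ∃ a t, 0 < t ∧ ∀ i : ℕ, ∃ w : List T, g.Derives β (w.map .terminal) ∧ M.evalFrom p w = q ∧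
      w.length = a + t * i := by
  obtain ⟨A, u, v, x, y, z, s, t, hu, hv, hx, eu, ev, ex, ey, ez, hpos⟩ := h
  have iter (i : ℕ) : ∃ m : List T, g.Derives [.nonterminal A] (m.map .terminal) ∧
      M.evalFrom s m = t ∧ m.length = x.length + (v.length + y.length) * i := by
    induction i with
    | zero => exact ⟨x, hx, ex, by simp⟩
    | succ i ih =>
      obtain ⟨m, hm, em, lm⟩ := ih
      refine ⟨v ++ m ++ y, ?_, ?_, ?_⟩
      · simpa using hv.trans ((hm.append_left _).append_right _)
      · simp [DFA.evalFrom_of_append, ev, em, ey]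
      · simp only [List.length_append, lm]
        ring
  refine ⟨u.length + x.length + z.length, v.length + y.length, hpos, fun i ↦ ?_⟩
  obtain ⟨m, hm, em, lm⟩ := iter i
  refine ⟨u ++ m ++ z, ?_, ?_, ?_⟩
  · simpa using hu.trans ((hm.append_left _).append_right _)
  · simp [DFA.evalFrom_of_append, eu, em, ez]
  · simp only [List.length_append, lm]
    ring

end ContextFreeGrammar

/-- If a context-free language has arbitrarily long words accepted by a finite automaton, then the
lengths of such words contain an infinite arithmetic progression. -/
theorem Language.IsContextFree.exists_length_accepts {T σ : Type*} [Finite σ] {L : Language T}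
    (hL : L.IsContextFree) (M : DFA T σ) (hM : ∀ N, ∃ w ∈ L, w ∈ M.accepts ∧ N ≤ w.length) :
    ∃ a t, 0 < t ∧ ∀ i : ℕ, ∃ w ∈ L, w ∈ M.accepts ∧ w.length = a + t * i := by
  classical
  obtain ⟨g, rfl⟩ := hL
  have := Fintype.ofFinite σ
  set U : Finset (g.NT × σ × σ) := g.rules.image ContextFreeRule.input ×ˢ Finset.univ with hU
  set K := g.rules.sup (fun r ↦ r.output.length) + 1
  obtain ⟨w, hw, hwM, hlen⟩ := hM (K ^ U.card + 1)
  obtain h | h := ContextFreeGrammar.derivesAlong_or_pumpable (M := M) (U := U)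
    (fun r hr s t ↦ by simpa [hU] using ⟨r, hr, rfl⟩) hw M.start
  · have := h.length_le (K := K) (Nat.succ_pos _) fun r hr ↦
      (Finset.le_sup (f := fun r ↦ r.output.length) hr).trans (Nat.le_succ _)
    simp only [List.length_singleton, one_mul] at this
    omega
  · obtain ⟨a, t, ht, h⟩ := h.exists_length
    refine ⟨a, t, ht, fun i ↦ ?_⟩
    obtain ⟨w', hd, he, hl⟩ := h i
    refine ⟨w', hd, ?_, hl⟩
    rw [DFA.mem_accepts, DFA.eval, he]
    exact hwM

/-- A function on lists is determined by windows of length `K` if inserting `b` between `a` and `c`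
obeys inclusion-exclusion as soon as `b` has length at least `K`. -/
def WindowAdditive {Γ : Type*} (K : ℕ) (F : List Γ → ℤ) : Prop :=
  ∀ a b c : List Γ, K ≤ b.length → F (a ++ b ++ c) + F b = F (a ++ b) + F (b ++ c)

namespace WindowAdditive

variable {Γ : Type*} {K : ℕ} {F : List Γ → ℤ}

lemma apply_flatten_replicate (hF : WindowAdditive K F) {w : List Γ} (hw : K ≤ w.length) (n : ℕ) :
    F (List.replicate (n + 1) w).flatten = F w + n * (F (w ++ w) - F w) := by
  induction n with
  | zero => simp
  | succ n ih =>
    have h := hF (List.replicate n w).flatten w w hw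
    have h₁ : (List.replicate (n + 1) w).flatten = (List.replicate n w).flatten ++ w := by
      simp [List.replicate_succ']
    have h₂ : (List.replicate (n + 1 + 1) w).flatten = (List.replicate n w).flatten ++ w ++ w := by
      simp [List.replicate_succ']
    rw [h₂]
    rw [h₁] at ih
    push_cast
    linarith

lemma apply_excise (hF : WindowAdditive K F) {b : List Γ} (hb : K ≤ b.length) (m p s : List Γ)
    (hc : F ((b ++ m) ++ (b ++ m)) = F (b ++ m)) :
    F (p ++ b ++ m ++ b ++ s) = F (p ++ b ++ s) := by
  have h₁ := hF p b (m ++ b ++ s) hb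
  have h₂ := hF (b ++ m) b s hb
  have h₃ := hF p b s hb
  have h₄ := hF (b ++ m) b m hb
  simp only [List.append_assoc] at *
  linarith

end WindowAdditive

lemma List.exists_repeated_block {Γ : Type*} [Fintype Γ] (K : ℕ) (x : List Γ)
    (hx : K * (Fintype.card (List.Vector Γ K) + 1) ≤ x.length) :
    ∃ p b m s : List Γ, b.length = K ∧ x = p ++ b ++ m ++ b ++ s := by
  set N := Fintype.card (List.Vector Γ K)
  have hle (i : Fin (N + 1)) : K * i + K ≤ x.length := by
    calc K * i + K = K * (i + 1) := by ring
      _ ≤ K * (N + 1) := Nat.mul_le_mul_left _ i.isLt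
      _ ≤ _ := hx
  let f : Fin (N + 1) → List.Vector Γ K := fun i ↦
    ⟨(x.drop (K * i)).take K, by have := hle i; simp; omega⟩
  obtain ⟨i, j, hij, hf⟩ := Fintype.exists_ne_map_eq_of_card_lt f (by simp [N])
  wlog hlt : i < j generalizing i j
  · exact this j i hij.symm hf.symm (lt_of_le_of_ne (not_lt.1 hlt) hij.symm)
  have hf' : (x.drop (K * i)).take K = (x.drop (K * j)).take K := congrArg Subtype.val hf
  have hKj : K * i + K ≤ K * j := by
    calc K * i + K = K * (i + 1) := by ring
      _ ≤ _ := Nat.mul_le_mul_left _ hlt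
  have hj := hle j
  refine ⟨x.take (K * i), (x.drop (K * i)).take K, (x.drop (K * i + K)).take (K * j - (K * i + K)),
    x.drop (K * j + K), by simp; omega, ?_⟩
  nth_rw 2 [hf']
  have e (a b : ℕ) : x.take a ++ (x.drop a).take b = x.take (a + b) := List.take_add.symm
  rw [e, e, show K * i + K + (K * j - (K * i + K)) = K * j by omega, e, List.take_append_drop]

/-- An unbounded window-additive function has nonzero slope along the powers of some word. -/
lemma WindowAdditive.exists_slope_ne_zero {Γ : Type*} [Finite Γ] {K : ℕ} {F : List Γ → ℤ}
    (hF : WindowAdditive K F) (hK : 0 < K) (hunbdd : ¬ ∃ B, ∀ x, |F x| ≤ B) :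
    ∃ w, K ≤ w.length ∧ F (w ++ w) - F w ≠ 0 := by
  have := Fintype.ofFinite Γ
  contrapose! hunbdd
  set N := K * (Fintype.card (List.Vector Γ K) + 1)
  have hshort (x : List Γ) : ∃ y : List Γ, y.length ≤ N ∧ F x = F y := by
    induction hn : x.length using Nat.strong_induction_on generalizing x with
    | _ n ih =>
      subst hn
      obtain hx | hx := le_total x.length N
      · exact ⟨x, hx, rfl⟩
      obtain ⟨p, b, m, s, hb, rfl⟩ := x.exists_repeated_block K hx
      obtain ⟨y, hy, hFy⟩ := ih _ (by simp; omega) (p ++ b ++ s) rfl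
      refine ⟨y, hy, hFy ▸ hF.apply_excise hb.ge m p s ?_⟩
      exact sub_eq_zero.1 (hunbdd (b ++ m) (by simp; omega))
  obtain ⟨B, hB⟩ := ((List.finite_length_le Γ N).image fun y ↦ |F y|).bddAbove
  refine ⟨B, fun x ↦ ?_⟩
  obtain ⟨y, hy, hxy⟩ := hshort x
  rw [hxy]
  exact hB ⟨y, hy, rfl⟩

lemma Int.natAbs_linear_eventually {c : ℤ} (hc : c ≠ 0) (d : ℤ) (t : ℕ) :
    ∃ N : ℕ, ∀ n : ℕ, N ≤ n → n ≤ (c * n + d).natAbs + N ∧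
      ∀ n' : ℕ, n ≤ n' → (c * n + d).natAbs ≤ (c * n' + d).natAbs ∧
        (n' ≤ n + t → (c * n' + d).natAbs ≤ 2 * (c * n + d).natAbs) := by
  wlog hpos : 0 < c generalizing c d
  · obtain ⟨N, hN⟩ := this (neg_ne_zero.2 hc) (-d) (by omega)
    refine ⟨N, ?_⟩
    have e (n : ℤ) : (-c * n + -d).natAbs = (c * n + d).natAbs := by
      rw [← Int.natAbs_neg]
      ring_nf
    simpa only [e] using hN
  refine ⟨d.natAbs + t, fun n hn ↦ ?_⟩
  zify at hn
  have hd := neg_le_abs d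
  have h₀ (x : ℤ) (hx : |d| + t ≤ x) : x - |d| ≤ c * x + d := by nlinarith [abs_nonneg d]
  have h₁ := h₀ n hn
  refine ⟨by zify; rw [abs_of_nonneg (by linarith)]; linarith, fun n' hn' ↦ ?_⟩
  zify at hn' ⊢
  have h₂ := h₀ n' (hn.trans hn')
  rw [abs_of_nonneg (by linarith), abs_of_nonneg (by linarith)]
  refine ⟨by nlinarith, fun hle ↦ ?_⟩
  nlinarith [le_abs_self d, mul_le_mul_of_nonneg_left hle hpos.le,
    mul_le_mul_of_nonneg_left hn hpos.le, abs_nonneg d]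

lemma Nat.size_two_mul_le (n : ℕ) : (2 * n).size ≤ n.size + 1 := by
  rw [Nat.size_le, pow_succ']
  have := n.lt_size_self
  omega

/-- If `m ≥ 2`, the values of `n ↦ m n + size |c n + d|` contain no infinite arithmetic
progression. -/
lemma Nat.no_progression_mul_add_size {m : ℕ} (hm : 2 ≤ m) {c : ℤ} (hc : c ≠ 0) (d : ℤ) {a t : ℕ}
    (ht : 0 < t) : ¬ ∀ i : ℕ, ∃ n : ℕ, m * n + (c * n + d).natAbs.size = a + t * i := by
  intro h
  choose ν hν using fun i ↦ h (m * i)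
  obtain ⟨N, hN⟩ := Int.natAbs_linear_eventually hc d t
  set g : ℕ → ℕ := fun n ↦ (c * n + d).natAbs with hg
  change ∀ n, N ≤ n → n ≤ g n + N ∧ ∀ n', n ≤ n' → g n ≤ g n' ∧ (n' ≤ n + t → g n' ≤ 2 * g n) at hN
  change ∀ i, m * ν i + (g (ν i)).size = a + t * (m * i) at hν
  have hlarge (R : ℕ) : ∃ i₀, ∀ i, i₀ ≤ i → R ≤ ν i := by
    set C := (Finset.range R).sup fun n ↦ m * n + (g n).size
    refine ⟨C + 1, fun i hi ↦ ?_⟩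
    by_contra! hlt
    have h₁ : m * ν i + (g (ν i)).size ≤ C :=
      Finset.le_sup (f := fun n ↦ m * n + (g n).size) (Finset.mem_range.2 hlt)
    have h₂ : i ≤ t * (m * i) := by
      rw [← mul_assoc]
      exact Nat.le_mul_of_pos_left i (by positivity)
    have := hν i
    omega
  obtain ⟨i₀, hi₀⟩ := hlarge N
  have hstep (i : ℕ) (hi : i₀ ≤ i) : (g (ν (i + 1))).size = (g (ν i)).size := by
    have hN₁ := hi₀ i hi
    have hN₂ := hi₀ (i + 1) (by omega)
    have e₁ := hν i
    have e₂ : m * ν (i + 1) + (g (ν (i + 1))).size = a + t * (m * i) + m * t := by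
      rw [hν]; ring
    have hpos : 0 < m * t := by positivity
    have hle : ν i ≤ ν (i + 1) := by
      by_contra! hlt
      have h₁ := Nat.size_le_size ((hN _ hN₂).2 _ hlt.le).1
      have h₂ := Nat.mul_le_mul_left m hlt.le
      omega
    have h₁ := Nat.size_le_size ((hN _ hN₁).2 _ hle).1
    have hle' : ν (i + 1) ≤ ν i + t := by
      refine le_of_mul_le_mul_left (a := m) ?_ (by omega)
      rw [mul_add]
      omega
    have h₂ := (Nat.size_le_size (((hN _ hN₁).2 _ hle).2 hle')).trans (Nat.size_two_mul_le _)
    obtain ⟨e, he⟩ := Nat.exists_eq_add_of_le hle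
    rw [he, mul_add] at e₂
    have hdvd : m ∣ (g (ν (i + 1))).size - (g (ν i)).size := by
      have h₃ : (g (ν (i + 1))).size - (g (ν i)).size = m * t - m * e := by
        rw [he] at h₁ ⊢
        omega
      rw [h₃]
      exact Nat.dvd_sub (dvd_mul_right _ _) (dvd_mul_right _ _)
    have := Nat.eq_zero_of_dvd_of_lt hdvd (by omega)
    omega
  have hconst (j : ℕ) : (g (ν (i₀ + j))).size = (g (ν i₀)).size := by
    induction j with
    | zero => rfl
    | succ j ih => rw [← ih, ← hstep (i₀ + j) (by omega)]; rfl
  obtain ⟨i₁, hi₁⟩ := hlarge (N + 2 ^ (g (ν i₀)).size)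
  have h₁ := hi₁ (i₀ + i₁) (by omega)
  have h₂ := (hN _ (hi₀ (i₀ + i₁) (by omega))).1
  have h₃ := (g (ν (i₀ + i₁))).lt_size_self
  rw [hconst] at h₃
  omega

namespace WordPowerDFA

variable {T : Type*} (W : List T) (c : T)

/-- The states are a position in `W`, a final state reached at `c` and a dead state. -/
abbrev State : Type := Option (Option (Fin W.length))

open Classical in
/-- The automaton accepting the words `W ⋯ W c v`, if `c` does not occur in `W`. -/
noncomputable def automaton (hW : 0 < W.length) : DFA T (State W) where
  step
    | none, _ => none
    | some none, _ => some none
    | some (some i), a =>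
      if a = W[i] then
        if h : i + 1 < W.length then some (some ⟨i + 1, h⟩) else some (some ⟨0, hW⟩)
      else if a = c ∧ (i : ℕ) = 0 then some none else none
  start := some (some ⟨0, hW⟩)
  accept := {some none}

variable {W c} {hW : 0 < W.length}

lemma evalFrom_none (w : List T) : (automaton W c hW).evalFrom none w = none := by
  induction w with
  | nil => rfl
  | cons a w ih => exact ih

lemma evalFrom_final (w : List T) : (automaton W c hW).evalFrom (some none) w = some none := by
  induction w with
  | nil => rfl
  | cons a w ih => exact ih

open Classical in
lemma step_position (i : Fin W.length) (a : T) :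
    (automaton W c hW).step (some (some i)) a =
      if a = W[i] then
        if h : i + 1 < W.length then some (some ⟨i + 1, h⟩) else some (some ⟨0, hW⟩)
      else if a = c ∧ (i : ℕ) = 0 then some none else none :=
  rfl

lemma exists_of_evalFrom {w : List T} {i : Fin W.length}
    (h : (automaton W c hW).evalFrom (some (some i)) w = some none) :
    ∃ n v, W.take i ++ w = (List.replicate n W).flatten ++ c :: v := by
  induction w generalizing i with
  | nil => cases h
  | cons a w ih =>
    have htake : W.take i ++ W[i] :: w = W.take (i + 1) ++ w := by
      rw [← List.take_concat_get' W i i.isLt, List.append_assoc]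
      rfl
    rw [DFA.evalFrom_cons, step_position] at h
    split_ifs at h with ha hi hc
    · obtain ⟨n, v, hv⟩ := ih h
      exact ⟨n, v, by rw [← hv, ha, htake]⟩
    · obtain ⟨n, v, hv⟩ := ih h
      refine ⟨n + 1, v, ?_⟩
      rw [ha, htake, List.take_of_length_le (by omega), List.replicate_succ, List.flatten_cons,
        List.append_assoc, ← hv]
      simp
    · exact ⟨0, w, by simp [hc]⟩
    · rw [evalFrom_none] at h
      cases h

lemma exists_of_mem_accepts {w : List T} (h : w ∈ (automaton W c hW).accepts) :
    ∃ n v, w = (List.replicate n W).flatten ++ c :: v := by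
  simpa using exists_of_evalFrom (i := ⟨0, hW⟩) h

lemma evalFrom_drop (j : ℕ) (hj : j < W.length) :
    (automaton W c hW).evalFrom (some (some ⟨j, hj⟩)) (W.drop j) = some (some ⟨0, hW⟩) := by
  induction hn : W.length - j generalizing j with
  | zero => omega
  | succ n ih =>
    rw [List.drop_eq_getElem_cons hj, DFA.evalFrom_cons]
    by_cases h : j + 1 < W.length
    · rw [← ih (j + 1) h (by omega)]
      simp [automaton, h]
    · rw [List.drop_eq_nil_of_le (by omega)]
      simp [automaton, h]

lemma mem_accepts (hc : c ∉ W) (n : ℕ) (v : List T) :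
    (List.replicate n W).flatten ++ c :: v ∈ (automaton W c hW).accepts := by
  rw [DFA.mem_accepts, DFA.eval]
  suffices h : (automaton W c hW).evalFrom (some (some ⟨0, hW⟩))
      ((List.replicate n W).flatten ++ c :: v) = some none from h
  induction n with
  | zero =>
    have : c ≠ W[0] := fun h ↦ hc (h ▸ List.getElem_mem _)
    simpa [automaton, this] using evalFrom_final v
  | succ n ih =>
    rw [List.replicate_succ, List.flatten_cons, List.append_assoc, DFA.evalFrom_of_append]
    have := evalFrom_drop (c := c) (hW := hW) 0 hW
    rw [List.drop_zero] at this
    rw [this, ih]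

end WordPowerDFA

section Energy

variable {q k p : ℕ} (h : Fin p → (Fin k → Option (Fin q)) → ℤ)

/-- All integer addresses occurring in the configuration lie in `{-k, …, k}`. -/
def ShortRange (x : Config q k p) : Prop :=
  ∀ a ∈ x, ∀ l z, a.2.2 l = some z → -(k : ℤ) ≤ z ∧ z ≤ k

/-- The contribution of site `j` to the energy, zero outside of the configuration. -/
def siteEnergy (x : Config q k p) (j : ℕ) : ℤ :=
  match x[j]? with
  | none => 0
  | some a => h a.2.1 fun l ↦ spinAt x j (a.2.2 l)

variable {h}

lemma energy_eq_sum_siteEnergy (x : Config q k p) :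
    energy h x = ∑ j ∈ Finset.range x.length, siteEnergy h x j := by
  rw [Finset.sum_range, energy]
  exact Finset.sum_congr rfl fun j _ ↦ by simp [siteEnergy]

lemma siteEnergy_append_left {x : Config q k p} (hx : ShortRange x) (y : Config q k p) {j : ℕ}
    (hj : j + k < x.length) : siteEnergy h (x ++ y) j = siteEnergy h x j := by
  have hj' : j < x.length := by omega
  simp only [siteEnergy, List.getElem?_append_left hj', List.getElem?_eq_getElem hj']
  congr 1
  ext1 l
  cases hz : x[j].2.2 l with
  | none => rfl
  | some z =>
    have := hx _ (List.getElem_mem hj') l z hz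
    simp only [spinAt]
    rw [List.getElem?_append_left (by omega)]

lemma siteEnergy_append_right (x : Config q k p) {y : Config q k p} (hy : ShortRange y) {j : ℕ}
    (hj : k ≤ j) : siteEnergy h (x ++ y) (x.length + j) = siteEnergy h y j := by
  have hget (i : ℕ) : (x ++ y)[x.length + i]? = y[i]? := by
    simp [List.getElem?_append_right]
  unfold siteEnergy
  rw [hget]
  cases ha : y[j]? with
  | none => rfl
  | some a =>
    simp only
    congr 1
    ext1 l
    cases hz : a.2.2 l with
    | none => rfl
    | some z =>
      have := hy a (List.mem_of_getElem? ha) l z hz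
      simp only [spinAt]
      rw [if_pos (by omega), if_pos (by omega),
        show (((x.length + j : ℕ) : ℤ) + z).toNat = x.length + ((j : ℤ) + z).toNat by omega, hget]

lemma ShortRange.append {x y : Config q k p} (hx : ShortRange x) (hy : ShortRange y) :
    ShortRange (x ++ y) := by
  intro a ha
  obtain ha | ha := List.mem_append.1 ha
  exacts [hx a ha, hy a ha]

/-- Inclusion-exclusion for the energy of overlapping configurations. -/
lemma energy_append_append {a b c : Config q k p} (ha : ShortRange a) (hb : ShortRange b)
    (hc : ShortRange c) (hlen : 2 * k ≤ b.length) :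
    energy h (a ++ b ++ c) + energy h b = energy h (a ++ b) + energy h (b ++ c) := by
  obtain ⟨m, hm⟩ := Nat.exists_eq_add_of_le (show k ≤ b.length by omega)
  have e₁ : (a ++ b ++ c).length = (a.length + k) + (m + c.length) := by simp; omega
  have e₂ : (a ++ b).length = (a.length + k) + m := by simp; omega
  have e₃ : (b ++ c).length = k + (m + c.length) := by simp; omega
  simp only [energy_eq_sum_siteEnergy, e₁, e₂, e₃, hm, Finset.sum_range_add _ (_ + _),
    Finset.sum_range_add _ k]
  have s₁ : ∑ j ∈ Finset.range (a.length + k), siteEnergy h (a ++ b ++ c) j =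
      ∑ j ∈ Finset.range (a.length + k), siteEnergy h (a ++ b) j :=
    Finset.sum_congr rfl fun j hj ↦ siteEnergy_append_left (ha.append hb) c (by
      have := Finset.mem_range.1 hj
      simp; omega)
  have s₂ : ∑ j ∈ Finset.range (m + c.length), siteEnergy h (a ++ b ++ c) (a.length + k + j) =
      ∑ j ∈ Finset.range (m + c.length), siteEnergy h (b ++ c) (k + j) :=
    Finset.sum_congr rfl fun j _ ↦ by
      rw [List.append_assoc, Nat.add_assoc, siteEnergy_append_right a (hb.append hc) (by omega)]
  have s₃ : ∑ j ∈ Finset.range m, siteEnergy h (a ++ b) (a.length + k + j) =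
      ∑ j ∈ Finset.range m, siteEnergy h b (k + j) :=
    Finset.sum_congr rfl fun j _ ↦ by
      rw [Nat.add_assoc, siteEnergy_append_right a hb (by omega)]
  have s₄ : ∑ j ∈ Finset.range k, siteEnergy h (b ++ c) j =
      ∑ j ∈ Finset.range k, siteEnergy h b j :=
    Finset.sum_congr rfl fun j hj ↦ siteEnergy_append_left hb c (by
      have := Finset.mem_range.1 hj
      omega)
  rw [s₁, s₂, s₃, s₄]
  ring

end Energy

section Encoding

variable {q k p : ℕ}

lemma List.append_cons_inj_of_left_notMem {α : Type*} {x₁ x₂ z₁ z₂ : List α} {a : α}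
    (h₁ : a ∉ x₁) (h₂ : a ∉ x₂) :
    x₁ ++ a :: z₁ = x₂ ++ a :: z₂ ↔ x₁ = x₂ ∧ z₁ = z₂ := by
  induction x₁ generalizing x₂ with
  | nil => cases x₂ <;> simp_all
  | cons b x₁ ih =>
    cases x₂ with
    | nil => simp_all [eq_comm]
    | cons c x₂ => simp_all [and_assoc]

lemma List.mem_of_mem_intercalate {α : Type*} {a b : α} {ls : List (List α)}
    (ha : a ∈ [b].intercalate ls) : a = b ∨ ∃ l ∈ ls, a ∈ l := by
  induction ls with
  | nil => simp at ha
  | cons l ls ih =>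
    cases ls with
    | nil => exact .inr ⟨l, by simpa using ha⟩
    | cons l' ls =>
      rw [List.intercalate_cons_cons, List.mem_append, List.mem_append, List.mem_singleton] at ha
      obtain (ha | ha) | ha := ha
      · exact .inr ⟨l, by simp, ha⟩
      · exact .inl ha
      · exact (ih ha).imp_right fun ⟨l, hl, hal⟩ ↦ ⟨l, List.mem_cons_of_mem _ hl, hal⟩

lemma mem_encAddr {z : Option ℤ} {a : Symb q p} (ha : a ∈ encAddr z) :
    a = .dia ∨ a = .sq ∨ a = .tri := by
  cases z with
  | none => simp_all [encAddr]
  | some z =>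
    simp only [encAddr, unary] at ha
    split_ifs at ha
    · exact .inl (List.eq_of_mem_replicate ha)
    · exact .inr (.inl (List.eq_of_mem_replicate ha))

lemma mem_intercalate_encAddr {A : Fin k → Option ℤ} {a : Symb q p}
    (ha : a ∈ [Symb.blank].intercalate (List.ofFn fun l ↦ encAddr (A l))) :
    a = .blank ∨ a = .dia ∨ a = .sq ∨ a = .tri := by
  obtain rfl | ⟨l, hl, hal⟩ := List.mem_of_mem_intercalate ha
  · exact .inl rfl
  · obtain ⟨i, rfl⟩ := (List.mem_ofFn' _ _).1 hl
    exact .inr (mem_encAddr hal)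

lemma unary_injective : Function.Injective (unary : ℤ → List (Symb q p)) := by
  intro z z' hz
  have hlen := congrArg List.length hz
  have hsq := congrArg (fun l ↦ Symb.sq ∈ l) hz
  unfold unary at hlen hsq
  split_ifs at hlen hsq <;> simp at hlen hsq <;> omega

lemma encAddr_injective : Function.Injective (encAddr : Option ℤ → List (Symb q p)) := by
  have aux (z : ℤ) : (Symb.tri : Symb q p) ∉ encAddr (some z) := by
    simp only [encAddr, unary]
    split_ifs <;> simp
  rintro (_ | z) (_ | z') hz
  · rfl
  · exact absurd (hz ▸ List.mem_singleton_self _) (aux z')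
  · exact absurd (hz ▸ List.mem_singleton_self _) (aux z)
  · exact congrArg some (unary_injective hz)

lemma encInt_append_inj (hk : 0 < k) {I I' : LocInt k p} {r r' : List (Symb q p)}
    (he : encInt I ++ r = encInt I' ++ r') : I = I' ∧ r = r' := by
  simp only [encInt, List.append_assoc, List.cons_append, List.nil_append, List.cons.injEq,
    Symb.ham.injEq, true_and] at he
  obtain ⟨hα, he⟩ := he
  have hrhd (A : Fin k → Option ℤ) : (Symb.rhd : Symb q p) ∉
      [Symb.blank].intercalate (List.ofFn fun l ↦ encAddr (A l)) := fun hmem ↦ by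
    simpa using mem_intercalate_encAddr hmem
  have hsplit (A : Fin k → Option ℤ) :
      ([(Symb.blank : Symb q p)].intercalate (List.ofFn fun l ↦ encAddr (A l))).splitOn Symb.blank =
        List.ofFn fun l ↦ encAddr (A l) := by
    refine List.splitOn_intercalate _ (fun l hl hmem ↦ ?_) (by simp; omega)
    obtain ⟨i, rfl⟩ := (List.mem_ofFn' _ _).1 hl
    simpa using mem_encAddr hmem
  have key : ([(Symb.blank : Symb q p)].intercalate (List.ofFn fun l ↦ encAddr (I.2 l))) =
      [Symb.blank].intercalate (List.ofFn fun l ↦ encAddr (I'.2 l)) ∧ r = r' := by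
    exact (List.append_cons_inj_of_left_notMem (hrhd I.2) (hrhd I'.2)).1 he
  refine ⟨Prod.ext hα (funext fun l ↦ encAddr_injective (q := q) (p := p) ?_), key.2⟩
  have := hsplit I.2
  rw [key.1, hsplit] at this
  exact congrFun (List.ofFn_injective this.symm) l

lemma encConfig_cons (a : Fin q × LocInt k p) (x : Config q k p) :
    encConfig (a :: x) = Symb.spin a.1 :: (encInt a.2 ++ encConfig x) := by
  simp [encConfig]

lemma encConfig_injective (hk : 0 < k) :
    Function.Injective (encConfig : Config q k p → List (Symb q p)) := by
  intro x
  induction x with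
  | nil =>
    rintro (_ | ⟨b, y⟩) hxy
    · rfl
    · rw [encConfig_cons] at hxy
      cases hxy
  | cons a x ih =>
    rintro (_ | ⟨b, y⟩) hxy
    · rw [encConfig_cons] at hxy
      cases hxy
    · simp only [encConfig_cons, List.cons.injEq, Symb.spin.injEq] at hxy
      obtain ⟨hI, hr⟩ := encInt_append_inj hk hxy.2
      rw [ih hr, Prod.ext hxy.1 hI]

lemma comp_notMem_encConfig (x : Config q k p) : Symb.comp ∉ encConfig x := by
  induction x with
  | nil => simp [encConfig]
  | cons a x ih =>
    have : (Symb.comp : Symb q p) ∉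
        [Symb.blank].intercalate (List.ofFn fun l ↦ encAddr (a.2.2 l)) := fun hmem ↦ by
      simpa using mem_intercalate_encAddr hmem
    rw [encConfig_cons]
    simp [encInt, ih, this]

lemma encConfig_flatten_replicate (n : ℕ) (x : Config q k p) :
    encConfig (List.replicate n x).flatten = (List.replicate n (encConfig x)).flatten := by
  induction n with
  | zero => rfl
  | succ n ih =>
    rw [List.replicate_succ, List.replicate_succ, List.flatten_cons, List.flatten_cons, ← ih]
    simp [encConfig]

lemma two_le_length_encConfig {x : Config q k p} (hx : x ≠ []) : 2 ≤ (encConfig x).length := by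
  obtain ⟨a, x, rfl⟩ := List.exists_cons_of_ne_nil hx
  rw [encConfig_cons]
  simp [encInt]

lemma length_binEnc (z : ℤ) : (binEnc z : List (Symb q p)).length = z.natAbs.size + 1 := by
  simp [binEnc, Nat.size_eq_bits_len]

end Encoding

lemma mem_domain1D_iff {q k p : ℕ} {S : Set (LocInt k p)} {x : Config q k p} :
    x ∈ Domain1D q S ↔ x ≠ [] ∧ ∀ a ∈ x, a.2 ∈ S := by
  simp [Domain1D, List.forall_mem_iff_get]

lemma Is1DIntSet.finite {k p : ℕ} {S : Set (LocInt k p)} (hS : Is1DIntSet S) : S.Finite := by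
  have hfin : (Set.univ ×ˢ Set.univ.pi fun _ ↦ some '' Set.Icc (-(k : ℤ)) k :
      Set (LocInt k p)).Finite :=
    Set.finite_univ.prod (Set.Finite.pi fun _ ↦ (Set.finite_Icc _ _).image _)
  refine hfin.subset fun I hI ↦ ⟨Set.mem_univ _, fun l _ ↦ ?_⟩
  obtain ⟨a, ha, hb⟩ := hS.2 I hI l
  exact ⟨a, hb, ha.symm⟩

/-- A 1D spin Hamiltonian with unbounded image is unbounded along the powers of some
configuration. -/
lemma exists_config_energy_flatten_replicate {q k p : ℕ} (hk : 0 < k)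
    (h : Fin p → (Fin k → Option (Fin q)) → ℤ)
    {S : Set (LocInt k p)} (hS : Is1DIntSet S)
    (hunbdd : ¬ ∃ B : ℤ, ∀ x ∈ Domain1D q S, |energy h x| ≤ B) :
    ∃ x ∈ Domain1D q S, ∃ c d : ℤ, c ≠ 0 ∧
      ∀ n : ℕ, energy h (List.replicate (n + 1) x).flatten = c * n + d := by
  have := hS.finite.to_subtype
  let φ : Fin q × S → Fin q × LocInt k p := fun a ↦ (a.1, a.2)
  have hshort (y : List (Fin q × S)) : ShortRange (y.map φ) := by
    rintro _ ha l z hz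
    obtain ⟨a, -, rfl⟩ := List.mem_map.1 ha
    obtain ⟨z', hz', hb⟩ := hS.2 _ a.2.2 l
    obtain rfl : z' = z := Option.some_injective _ (hz'.symm.trans hz)
    exact hb
  have hF : WindowAdditive (2 * k) fun y : List (Fin q × S) ↦ energy h (y.map φ) := by
    intro a b c hb
    simpa using energy_append_append (hshort a) (hshort b) (hshort c) (by simpa using hb)
  obtain ⟨w, hw, hc⟩ := hF.exists_slope_ne_zero (by omega) fun ⟨B, hB⟩ ↦ hunbdd ⟨B, fun x hx ↦ by
    obtain ⟨y, rfl⟩ : x ∈ Set.range (List.map φ) := by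
      rw [Set.range_list_map]
      exact fun a ha ↦ ⟨(a.1, ⟨a.2, (mem_domain1D_iff.1 hx).2 a ha⟩), rfl⟩
    exact hB y⟩
  refine ⟨w.map φ, mem_domain1D_iff.2 ⟨?_, ?_⟩, _, energy h (w.map φ), hc, fun n ↦ ?_⟩
  · rw [ne_eq, List.map_eq_nil_iff, ← List.length_eq_zero_iff]
    omega
  · rintro _ ha
    obtain ⟨a, -, rfl⟩ := List.mem_map.1 ha
    exact a.2.2
  · have := hF.apply_flatten_replicate hw n
    simp only [List.map_flatten, List.map_replicate] at this
    rw [this]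
    ring


/-- If `H` is a 1D spin Hamiltonian with unbounded image (i.e. `H` is
not effectively 0D), then its language with binary energy encoding `L_H^b` is not
context-free. -/
theorem oneD_binary_not_contextFree {q k p : ℕ} (hq : 0 < q) (hk : 0 < k) (hp : 0 < p)
    (h : Fin p → (Fin k → Option (Fin q)) → ℤ)
    (S : Set (LocInt k p)) (hS : Is1DIntSet S)
    (hunbdd : ¬ ∃ B : ℤ, ∀ x ∈ Domain1D q S, |energy h x| ≤ B) :
    ¬ (langHB h (Domain1D q S)).IsContextFree := by
  intro hL
  obtain ⟨x, hx, c, d, hc, hE⟩ := exists_config_energy_flatten_replicate hk h hS hunbdd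
  rw [mem_domain1D_iff] at hx
  set W := encConfig x with hWdef
  have hW : 2 ≤ W.length := two_le_length_encConfig hx.1
  obtain ⟨a, t, ht, hAP⟩ := hL.exists_length_accepts
    (WordPowerDFA.automaton W .comp (by omega)) fun N ↦ by
      refine ⟨_, ⟨(List.replicate (N + 1) x).flatten, ?_, rfl⟩, ?_, ?_⟩
      · rw [mem_domain1D_iff]
        refine ⟨by simp [List.replicate_succ, hx.1], fun b hb ↦ ?_⟩
        obtain ⟨l, hl, hbl⟩ := List.mem_flatten.1 hb
        exact hx.2 b (List.eq_of_mem_replicate hl ▸ hbl)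
      · simp only [encConfig_flatten_replicate, List.append_assoc, List.singleton_append]
        exact WordPowerDFA.mem_accepts (comp_notMem_encConfig x) _ _
      · have : N ≤ (N + 1) * W.length := by nlinarith
        simp only [encConfig_flatten_replicate, List.length_append, List.length_flatten,
          List.map_replicate, List.sum_replicate, smul_eq_mul, ← hWdef]
        omega
  refine Nat.no_progression_mul_add_size (a := a + t * (W.length + 3) - (W.length + 3)) hW hc d ht
    fun i ↦ ?_
  obtain ⟨_, ⟨y, hy, rfl⟩, hacc, hlen⟩ := hAP (i + (W.length + 3))
  obtain ⟨n, v, hv⟩ := WordPowerDFA.exists_of_mem_accepts hacc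
  rw [← encConfig_flatten_replicate, List.append_assoc, List.append_assoc, List.singleton_append,
    List.append_cons_inj_of_left_notMem (comp_notMem_encConfig _) (comp_notMem_encConfig _)] at hv
  obtain rfl := encConfig_injective hk hv.1
  obtain _ | n := n
  · exact absurd rfl hy.1
  refine ⟨n, ?_⟩
  rw [← hE]
  have h₁ : W.length + 3 ≤ t * (W.length + 3) := Nat.le_mul_of_pos_left _ ht
  simp only [encConfig_flatten_replicate, List.length_append, List.length_flatten,
    List.map_replicate, List.sum_replicate, smul_eq_mul, ← hWdef, length_binEnc,
    List.length_singleton, add_mul, mul_add t, one_mul] at hlen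
  rw [mul_add t] at h₁ ⊢
  rw [mul_comm W.length n]
  omega
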